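/- Theorem 4.4. Let ω₀ = ω₀(n) ≤ ln ln n be any function tending to infinity as n → ∞, and suppose k = k(n) satisfies n^{1/3}/ln n ≤ k ≤ n/ω₀. Then there exists a constant C > 0 such that asymptotically almost surely |ξ(K_n, k)·k/(2 n ln k) − 1| ≤ C/ω₀; in particular, a.a.s. ξ(K_n,k) ~ 2 n ln k / k. -/

import Mathlib

open Finset Filter

/-- Positions: `p t a` is the vertex (an element of `Fin n`) occupied by agent `a` at the end of
round `t`. `greenSet n k p t` is the set of green agents at the end of round `t`; the initially
green agent is the agent with index `0`, and a white agent becomes green as soon as it occupies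
the same vertex as a green agent. -/
def greenSet (n k : ℕ) (p : ℕ → Fin k → Fin n) : ℕ → Finset (Fin k)
  | 0 => Finset.univ.filter fun a => ∃ b : Fin k, (b : ℕ) = 0 ∧ p 0 a = p 0 b
  | t + 1 =>
      greenSet n k p t ∪
        Finset.univ.filter fun a => ∃ b ∈ greenSet n k p t, p (t + 1) a = p (t + 1) b

/-- The probability that the `k` agents follow the trajectory prefix `p` during rounds
`0, 1, …, T`: each agent starts at a uniformly random vertex of `K_n` and then moves, each round
and independently of everything else, to a uniformly random vertex distinct from its current
one. -/
noncomputable def prefixProb (n k T : ℕ) (p : Fin (T + 1) → Fin k → Fin n) : ℝ :=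
  ∏ a : Fin k, ((n : ℝ)⁻¹ *
    ∏ t : Fin T, if p t.succ a = p t.castSucc a then 0 else ((n : ℝ) - 1)⁻¹)

/-- `probXiLe n k T` is `P(ξ(K_n, k) ≤ T)`: the probability that the broadcast is complete by
the end of round `T`. -/
noncomputable def probXiLe (n k T : ℕ) : ℝ :=
  ∑ p : Fin (T + 1) → Fin k → Fin n,
    if greenSet n k (fun t a => p ⟨min t T, Nat.lt_succ_of_le (min_le_right t T)⟩ a) T
        = Finset.univ
      then prefixProb n k T p else 0

/-- `probXiEq n k t` is `P(ξ(K_n, k) = t)`. -/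
noncomputable def probXiEq (n k : ℕ) : ℕ → ℝ
  | 0 => probXiLe n k 0
  | t + 1 => probXiLe n k (t + 1) - probXiLe n k t

/-- `probXiMem n k S` is `P(ξ(K_n, k) ∈ S)`: the probability that the broadcasting time of the
process with `k` agents on `K_n` belongs to the set `S ⊆ ℕ`. -/
noncomputable def probXiMem (n k : ℕ) (S : Set ℕ) : ℝ :=
  ∑' t, S.indicator (probXiEq n k) t

/-- `expXi n k = E[ξ(K_n, k)] = ∑_{t ≥ 0} P(ξ(K_n, k) > t)`. -/
noncomputable def expXi (n k : ℕ) : ℝ :=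
  ∑' t, (1 - probXiLe n k t)

/-- Expectation of `f y` when the coordinates `y a` are independent with weights `μ a`. -/
noncomputable def prodExp {A V : Type*} [Fintype A] [DecidableEq A] [Fintype V]
    (μ : A → V → ℝ) (f : (A → V) → ℝ) : ℝ :=
  ∑ y : A → V, (∏ a, μ a (y a)) * f y

section prodExp

variable {A V : Type*} [Fintype A] [DecidableEq A] [Fintype V]

lemma prodExp_mono {μ : A → V → ℝ} (hμ : ∀ a v, 0 ≤ μ a v) {f g : (A → V) → ℝ}
    (h : ∀ y, f y ≤ g y) : prodExp μ f ≤ prodExp μ g :=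
  Finset.sum_le_sum fun y _ =>
    mul_le_mul_of_nonneg_left (h y) (Finset.prod_nonneg fun a _ => hμ a (y a))

lemma prodExp_const {μ : A → V → ℝ} (hμ : ∀ a, ∑ v, μ a v = 1) (c : ℝ) :
    prodExp μ (fun _ => c) = c := by
  unfold prodExp
  rw [← Finset.sum_mul, ← Fintype.prod_sum]
  simp [hμ]

lemma prodExp_add (μ : A → V → ℝ) (f g : (A → V) → ℝ) :
    prodExp μ (fun y => f y + g y) = prodExp μ f + prodExp μ g := by
  simp [prodExp, mul_add, Finset.sum_add_distrib]

lemma prodExp_const_mul (μ : A → V → ℝ) (c : ℝ) (f : (A → V) → ℝ) :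
    prodExp μ (fun y => c * f y) = c * prodExp μ f := by
  simp only [prodExp, Finset.mul_sum]
  exact Finset.sum_congr rfl fun y _ => by ring

lemma prodExp_equiv {B : Type*} [Fintype B] [DecidableEq B] (e : A ≃ B) (μ : B → V → ℝ)
    (f : (B → V) → ℝ) :
    prodExp (fun a => μ (e a)) (fun y => f (y ∘ e.symm)) = prodExp μ f := by
  unfold prodExp
  refine Fintype.sum_equiv (Equiv.arrowCongr e (Equiv.refl V)) _ _ fun y => ?_
  congr 1
  exact Fintype.prod_equiv e _ _ fun a => by simp [Equiv.arrowCongr]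

/-- Conditioning on the coordinates in `G`, the remaining coordinates can be integrated out
one by one. -/
lemma prodExp_split [DecidableEq V] (μ : A → V → ℝ) (G : Finset A) (c : Finset V → V → ℝ) :
    prodExp μ (fun y => ∏ a ∈ Gᶜ, c (G.image y) (y a)) =
      prodExp (fun a : {a // a ∈ G} => μ a)
        (fun g => ∏ a : {a // a ∉ G}, ∑ v, μ a v * c (Finset.univ.image g) v) := by
  unfold prodExp
  rw [← (Equiv.piEquivPiSubtypeProd (fun a => a ∈ G) (fun _ => V)).symm.sum_comp,
    Fintype.sum_prod_type]
  refine Finset.sum_congr rfl fun g _ => ?_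
  dsimp only
  rw [Fintype.prod_sum, Finset.mul_sum]
  refine Finset.sum_congr rfl fun z _ => ?_
  have him : G.image ((Equiv.piEquivPiSubtypeProd (fun a => a ∈ G) (fun _ => V)).symm (g, z))
      = Finset.univ.image g := by
    ext v
    simp only [Finset.mem_image, Finset.mem_univ, true_and, Subtype.exists]
    constructor
    · rintro ⟨a, ha, rfl⟩
      exact ⟨a, ha, by simp [Equiv.piEquivPiSubtypeProd, ha]⟩
    · rintro ⟨a, ha, rfl⟩
      exact ⟨a, ha, by simp [Equiv.piEquivPiSubtypeProd, ha]⟩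
  rw [him, Finset.prod_mul_distrib, ← mul_assoc,
    ← Fintype.prod_subtype_mul_prod_subtype (fun a => a ∈ G),
    Finset.prod_subtype Gᶜ (p := fun a => a ∉ G) (by simp)]
  congr 1
  · congr 1
    · have h : ∀ a : {a // a ∈ G}, μ a ((Equiv.piEquivPiSubtypeProd (fun a => a ∈ G)
          (fun _ => V)).symm (g, z) a) = μ a (g a) := fun a => by
        simp [Equiv.piEquivPiSubtypeProd, a.2]
      simp only [h]
      congr!
    · exact Finset.prod_congr rfl fun a _ => by simp [Equiv.piEquivPiSubtypeProd, a.2]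
  · exact Finset.prod_congr rfl fun a _ => by simp [Equiv.piEquivPiSubtypeProd, a.2]

end prodExp

section kernelBounds

variable {A V : Type*} [Fintype A] [DecidableEq A] [DecidableEq V]

/-- The green set after a round ending in positions `y`, starting from the green set `G`. -/
def spread (G : Finset A) (y : A → V) : Finset A :=
  G ∪ Finset.univ.filter fun a => ∃ b ∈ G, y a = y b

lemma subset_spread (G : Finset A) (y : A → V) : G ⊆ spread G y := Finset.subset_union_left

lemma compl_spread (G : Finset A) (y : A → V) :
    (spread G y)ᶜ = Gᶜ.filter fun a => y a ∉ G.image y := by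
  ext a
  simp only [spread, Finset.mem_compl, Finset.mem_union, Finset.mem_filter, Finset.mem_univ,
    true_and, Finset.mem_image, not_or]
  refine and_congr_right fun _ => not_congr ?_
  exact exists_congr fun b => and_congr_right fun _ => eq_comm

lemma spread_sdiff (G : Finset A) (y : A → V) :
    spread G y \ G = Gᶜ.filter fun a => y a ∈ G.image y := by
  ext a
  simp only [spread, Finset.mem_sdiff, Finset.mem_compl, Finset.mem_union, Finset.mem_filter,
    Finset.mem_univ, true_and, Finset.mem_image]
  constructor
  · rintro ⟨h | ⟨b, hb, h⟩, h'⟩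
    · exact absurd h h'
    · exact ⟨h', b, hb, h.symm⟩
  · rintro ⟨h', b, hb, h⟩
    exact ⟨Or.inr ⟨b, hb, h.symm⟩, h'⟩

variable [Fintype V]

lemma sum_mul_ite (ν : V → ℝ) (hν : ∑ v, ν v = 1) (I : Finset V) (s t : ℝ) :
    ∑ v, ν v * (if v ∈ I then s else t) = t + (s - t) * ∑ v ∈ I, ν v := by
  have h : ∀ v, ν v * (if v ∈ I then s else t) = t * ν v + (s - t) * (if v ∈ I then ν v else 0) := by
    intro v; split_ifs <;> ring
  simp only [h, Finset.sum_add_distrib, ← Finset.mul_sum, hν]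
  simp

/-- Given the new positions of the green agents, every white agent stays white with probability
at least `1 - |G| p`. -/
lemma prodExp_pow_card_compl_spread_le {μ : A → V → ℝ} (h0 : ∀ a v, 0 ≤ μ a v)
    (h1 : ∀ a, ∑ v, μ a v = 1) {p : ℝ} (hp0 : 0 ≤ p)
    (hp : ∀ a v, μ a v ≤ p) (G : Finset A) {u : ℝ}
    (hu0 : 0 ≤ u) (hu1 : u ≤ 1) :
    prodExp μ (fun y => (1 - u) ^ (spread G y)ᶜ.card) ≤ (1 - (1 - G.card * p) * u) ^ Gᶜ.card := by
  have hrew : ∀ y : A → V, (1 - u) ^ (spread G y)ᶜ.card =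
      ∏ a ∈ Gᶜ, (fun (I : Finset V) v => if v ∈ I then (1 : ℝ) else 1 - u) (G.image y) (y a) := by
    intro y
    rw [compl_spread, Finset.prod_ite, Finset.prod_const_one, one_mul, Finset.prod_const]
  simp only [hrew]
  rw [prodExp_split μ G (fun I v => if v ∈ I then (1 : ℝ) else 1 - u)]
  refine (prodExp_mono (μ := fun a : {a // a ∈ G} => μ a) (fun a v => h0 a v)
    (g := fun _ => (1 - (1 - G.card * p) * u) ^ Gᶜ.card) fun g => ?_).trans
    (prodExp_const (μ := fun a : {a // a ∈ G} => μ a) (fun a => h1 a) _).le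
  have hcard : Gᶜ.card = (Finset.univ : Finset {a // a ∉ G}).card := by
    rw [Finset.card_univ, Fintype.card_subtype_compl, Finset.card_compl]
    simp
  rw [hcard, ← Finset.prod_const]
  refine Finset.prod_le_prod (fun a _ => Finset.sum_nonneg fun v _ =>
    mul_nonneg (h0 a v) (by split_ifs <;> linarith)) fun a _ => ?_
  rw [sum_mul_ite _ (h1 a)]
  have hsum : ∑ v ∈ Finset.univ.image g, μ a v ≤ G.card * p := by
    refine (Finset.sum_le_card_nsmul _ _ p fun v _ => hp a v).trans ?_
    rw [nsmul_eq_mul]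
    refine mul_le_mul_of_nonneg_right ?_ hp0
    exact_mod_cast Finset.card_image_le.trans (by simp)
  nlinarith

/-- Weights of a move to a vertex different from the current one. -/
noncomputable def moveWeight (p : ℝ) {A : Type*} (x : A → V) (a : A) (v : V) : ℝ :=
  if v = x a then 0 else p

omit [Fintype A] [DecidableEq A] [Fintype V] in
lemma moveWeight_nonneg {p : ℝ} (hp : 0 ≤ p) (x : A → V) (a : A) (v : V) :
    0 ≤ moveWeight p x a v := by
  unfold moveWeight; split_ifs <;> simp [hp]

omit [Fintype A] [DecidableEq A] [Fintype V] in
lemma moveWeight_le {p : ℝ} (hp : 0 ≤ p) (x : A → V) (a : A) (v : V) :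
    moveWeight p x a v ≤ p := by
  unfold moveWeight; split_ifs <;> simp [hp]

omit [Fintype A] [DecidableEq A] in
lemma sum_moveWeight_mul (p : ℝ) (x : A → V) (a : A) (f : V → ℝ) :
    ∑ v, moveWeight p x a v * f v = p * (∑ v, f v - f (x a)) := by
  have h : ∀ v, moveWeight p x a v * f v = p * (f v - if v = x a then f v else 0) := by
    intro v; unfold moveWeight; split_ifs <;> ring
  simp only [h, ← Finset.mul_sum, Finset.sum_sub_distrib]
  simp

omit [Fintype A] [DecidableEq A] in
lemma sum_moveWeight {p : ℝ} (hp : ((Fintype.card V : ℝ) - 1) * p = 1) (x : A → V) (a : A) :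
    ∑ v, moveWeight p x a v = 1 := by
  have := sum_moveWeight_mul p x a (fun _ => 1)
  simp only [mul_one, Finset.sum_const, Finset.card_univ, nsmul_eq_mul] at this
  rw [this, mul_comm, hp]

lemma exp_neg_le_quadratic {t : ℝ} (ht : 0 ≤ t) : Real.exp (-t) ≤ 1 - t + t ^ 2 := by
  have h1 : 1 + t ≤ Real.exp t := by linarith [Real.add_one_le_exp t]
  rw [Real.exp_neg, inv_le_iff_one_le_mul₀ (Real.exp_pos t)]
  have h2 : 0 ≤ 1 - t + t ^ 2 := by nlinarith [sq_nonneg (t - 1)]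
  nlinarith [mul_le_mul_of_nonneg_left h1 h2, pow_nonneg ht 3]

omit [Fintype A] [DecidableEq A] in
/-- A single agent moving to a vertex outside of `I` collects `h v`. -/
lemma sum_moveWeight_mul_exp_le {p : ℝ} (hp0 : 0 ≤ p) (hp : ((Fintype.card V : ℝ) - 1) * p = 1)
    (x : A → V) (a : A) (h : V → ℝ) {w l : ℝ} (hw : 0 ≤ w) (hl : 0 ≤ l) (h0 : ∀ v, 0 ≤ h v)
    (hle : ∀ v, h v ≤ w) (hsum : Fintype.card V * w - w ≤ ∑ v, h v) (I : Finset V) :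
    ∑ v, moveWeight p x a v * Real.exp (-l * if v ∈ I then 0 else h v) ≤
      Real.exp (-(l * w * (1 - (I.card + 1) * p - l * w))) := by
  set b : V → ℝ := fun v => if v ∈ I then 0 else h v with hb
  have hb0 : ∀ v, 0 ≤ b v := fun v => by simp only [hb]; split_ifs <;> simp [h0]
  have hbw : ∀ v, b v ≤ w := fun v => by simp only [hb]; split_ifs <;> simp [hw, hle]
  have hexp : ∀ v, Real.exp (-l * b v) ≤ (1 + (l * w) ^ 2) - l * b v := by
    intro v
    have h1 := exp_neg_le_quadratic (mul_nonneg hl (hb0 v))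
    have h2 : (l * b v) ^ 2 ≤ (l * w) ^ 2 := by
      gcongr
      · exact mul_nonneg hl (hb0 v)
      · exact hbw v
    rw [neg_mul]; linarith
  have hbsum : ∑ v, h v - I.card * w ≤ ∑ v, b v := by
    have h1 : ∀ v, b v = h v - if v ∈ I then h v else 0 := by
      intro v; simp only [hb]; split_ifs <;> simp
    simp only [h1, Finset.sum_sub_distrib]
    have h2 : ∑ v ∈ I, h v ≤ I.card * w := by
      simpa using Finset.sum_le_card_nsmul I h w fun v _ => hle v
    simp only [Finset.sum_ite_mem, Finset.univ_inter]
    linarith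
  calc ∑ v, moveWeight p x a v * Real.exp (-l * b v)
      ≤ ∑ v, moveWeight p x a v * ((1 + (l * w) ^ 2) - l * b v) :=
        Finset.sum_le_sum fun v _ =>
          mul_le_mul_of_nonneg_left (hexp v) (moveWeight_nonneg hp0 x a v)
    _ = (1 + (l * w) ^ 2) - l * (p * (∑ v, b v - b (x a))) := by
        rw [← sum_moveWeight_mul p x a]
        simp only [mul_sub, Finset.sum_sub_distrib, ← Finset.sum_mul, sum_moveWeight hp x a,
          Finset.mul_sum]
        rw [one_mul]
        congr 1
        exact Finset.sum_congr rfl fun v _ => by ring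
    _ ≤ 1 - l * w * (1 - (I.card + 1) * p - l * w) := by
        have h3 : p * ((Fintype.card V - 2 - I.card) * w) ≤ p * (∑ v, b v - b (x a)) := by
          gcongr
          linarith [hbw (x a)]
        have h4 := mul_le_mul_of_nonneg_left h3 hl
        have h5 : p * ((Fintype.card V - 2 - I.card) * w) = w * (1 - (I.card + 1) * p) := by
          linear_combination w * hp
        rw [h5] at h4
        nlinarith
    _ ≤ _ := by
        have := Real.add_one_le_exp (-(l * w * (1 - (I.card + 1) * p - l * w)))
        linarith

/-- Laplace transform of the `h`-weight of the set of vertices occupied after a move. -/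
lemma prodExp_exp_image_le {p : ℝ} (hp0 : 0 ≤ p) (hp : ((Fintype.card V : ℝ) - 1) * p = 1)
    (h : V → ℝ) {w l : ℝ} (hw : 0 ≤ w) (hl : 0 ≤ l) (h0 : ∀ v, 0 ≤ h v)
    (hle : ∀ v, h v ≤ w) (hsum : Fintype.card V * w - w ≤ ∑ v, h v) {M : ℕ} :
    ∀ m ≤ M, ∀ x : Fin m → V,
      prodExp (moveWeight p x) (fun y => Real.exp (-l * ∑ v ∈ Finset.univ.image y, h v)) ≤
        Real.exp (-(m * (l * w * (1 - (M + 1) * p - l * w)))) := by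
  intro m
  induction m with
  | zero => intro _ x; simp [prodExp]
  | succ m ih =>
    intro hm x
    set c := l * w * (1 - (M + 1) * p - l * w) with hc
    have hstep : ∀ z : Fin m → V, ∑ v, moveWeight p x 0 v *
        Real.exp (-l * if v ∈ Finset.univ.image z then 0 else h v) ≤ Real.exp (-c) := by
      intro z
      refine (sum_moveWeight_mul_exp_le hp0 hp x 0 h hw hl h0 hle hsum _).trans ?_
      refine Real.exp_le_exp.2 (neg_le_neg ?_)
      rw [hc]
      have hcard : ((Finset.univ.image z).card : ℝ) ≤ M := by
        exact_mod_cast Finset.card_image_le.trans (by simp; omega)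
      gcongr
    have key : prodExp (moveWeight p x)
        (fun y => Real.exp (-l * ∑ v ∈ Finset.univ.image y, h v)) =
        prodExp (moveWeight p (Fin.tail x)) (fun z =>
          Real.exp (-l * ∑ v ∈ Finset.univ.image z, h v) * ∑ v, moveWeight p x 0 v *
            Real.exp (-l * if v ∈ Finset.univ.image z then 0 else h v)) := by
      unfold prodExp
      rw [← (Fin.consEquiv (fun _ : Fin (m + 1) => V)).sum_comp, Fintype.sum_prod_type,
        Finset.sum_comm]
      refine Finset.sum_congr rfl fun z _ => ?_
      dsimp only
      rw [Finset.mul_sum, Finset.mul_sum]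
      refine Finset.sum_congr rfl fun v _ => ?_
      have him : Finset.univ.image (Fin.consEquiv (fun _ : Fin (m + 1) => V) (v, z)) =
          insert v (Finset.univ.image z) := by
        ext u
        simp [Fin.consEquiv, Fin.exists_fin_succ, eq_comm]
      have hs : ∑ u ∈ insert v (Finset.univ.image z), h u =
          ∑ u ∈ Finset.univ.image z, h u + if v ∈ Finset.univ.image z then 0 else h v := by
        split_ifs with hv
        · rw [Finset.insert_eq_of_mem hv, add_zero]
        · rw [Finset.sum_insert hv, add_comm]
      have hprod : ∏ a, moveWeight p x a (Fin.consEquiv (fun _ : Fin (m + 1) => V) (v, z) a) =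
          moveWeight p x 0 v * ∏ a, moveWeight p (Fin.tail x) a (z a) := by
        rw [Fin.prod_univ_succ]; rfl
      rw [him, hs, hprod, mul_add, Real.exp_add]
      ring
    rw [key]
    calc _ ≤ prodExp (moveWeight p (Fin.tail x)) (fun z => Real.exp (-c) *
          Real.exp (-l * ∑ v ∈ Finset.univ.image z, h v)) :=
          prodExp_mono (moveWeight_nonneg hp0 _) fun z => by
            rw [mul_comm]
            exact mul_le_mul_of_nonneg_right (hstep z) (Real.exp_pos _).le
      _ ≤ Real.exp (-c) * Real.exp (-(m * c)) := by
          rw [prodExp_const_mul]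
          exact mul_le_mul_of_nonneg_left (ih (by omega) _) (Real.exp_pos _).le
      _ = _ := by
          rw [← Real.exp_add]; congr 1; push_cast; ring

/-- The number of newly green agents is at least as concentrated as a Poisson variable with
mean `|G| (k - |G|) p (1 - (k + 1) p)`. -/
lemma prodExp_pow_card_spread_sdiff_le {p : ℝ} (hp0 : 0 ≤ p)
    (hp : ((Fintype.card V : ℝ) - 1) * p = 1) (x : A → V) (G : Finset A) {u : ℝ}
    (hu0 : 0 ≤ u) (hu1 : u ≤ 1) :
    prodExp (moveWeight p x) (fun y => (1 - u) ^ (spread G y \ G).card) ≤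
      Real.exp (-(u * (G.card * Gᶜ.card * p * (1 - (Fintype.card A + 1) * p)))) := by
  have hrew : ∀ y : A → V, (1 - u) ^ (spread G y \ G).card =
      ∏ a ∈ Gᶜ, (fun (I : Finset V) v => if v ∈ I then 1 - u else (1 : ℝ)) (G.image y) (y a) := by
    intro y
    rw [spread_sdiff, Finset.prod_ite, Finset.prod_const_one, mul_one, Finset.prod_const]
  simp only [hrew]
  rw [prodExp_split (moveWeight p x) G (fun I v => if v ∈ I then 1 - u else (1 : ℝ))]
  set w : ℝ := (Gᶜ.card : ℝ) with hwdef
  set l : ℝ := u * p with hl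
  have hl0 : 0 ≤ l := mul_nonneg hu0 hp0
  set h : V → ℝ := fun v => ((Gᶜ.filter fun a => x a ≠ v).card : ℝ) with hh
  have hle : ∀ v, h v ≤ w := fun v => by
    simp only [hh, hwdef]; exact_mod_cast Finset.card_filter_le _ _
  have hsum : ∑ v, h v = Fintype.card V * w - w := by
    have h1 : ∀ v, h v = ∑ a ∈ Gᶜ, (1 - if v = x a then (1:ℝ) else 0) := by
      intro v
      simp only [hh, Finset.card_filter]
      push_cast
      refine Finset.sum_congr rfl fun a _ => ?_
      by_cases hv : x a = v
      · simp [hv]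
      · simp [hv, Ne.symm hv]
    simp only [h1]
    rw [Finset.sum_comm]
    simp [Finset.card_univ, hwdef]
    ring
  have hpt : ∀ g : {a // a ∈ G} → V, ∏ a : {a // a ∉ G}, ∑ v, moveWeight p x a v *
      (if v ∈ Finset.univ.image g then 1 - u else (1 : ℝ)) ≤
      Real.exp (-l * ∑ v ∈ Finset.univ.image g, h v) := by
    intro g
    set I := Finset.univ.image g
    have h2 : ∀ a : A, ∑ v ∈ I, moveWeight p x a v = p * ∑ v ∈ I, if x a ≠ v then (1:ℝ) else 0 := by
      intro a
      rw [Finset.mul_sum]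
      refine Finset.sum_congr rfl fun v _ => ?_
      unfold moveWeight
      by_cases hv : x a = v
      · simp [hv]
      · simp [hv, Ne.symm hv]
    have h3 : -l * ∑ v ∈ I, h v = ∑ a : {a // a ∉ G}, -(l * ∑ v ∈ I, if x a ≠ v then (1:ℝ) else 0) := by
      rw [← Finset.sum_subtype Gᶜ (p := fun a => a ∉ G) (by simp)
        (fun a => -(l * ∑ v ∈ I, if x a ≠ v then (1:ℝ) else 0)), Finset.sum_neg_distrib,
        ← Finset.mul_sum, neg_mul, Finset.sum_comm]
      simp only [hh, Finset.card_filter]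
      push_cast
      rfl
    rw [h3, Real.exp_sum]
    refine Finset.prod_le_prod (fun a _ => Finset.sum_nonneg fun v _ =>
      mul_nonneg (moveWeight_nonneg hp0 x a v) (by split_ifs <;> linarith)) fun a _ => ?_
    rw [sum_mul_ite _ (sum_moveWeight hp x a), h2]
    have := Real.add_one_le_exp (-(l * ∑ v ∈ I, if x a ≠ v then (1:ℝ) else 0))
    refine le_trans (le_of_eq ?_) this
    rw [hl]; ring
  refine (prodExp_mono (μ := fun a : {a // a ∈ G} => moveWeight p x a)
    (fun a v => moveWeight_nonneg hp0 x a v) hpt).trans ?_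
  have e : {a // a ∈ G} ≃ Fin G.card := G.equivFin
  have h4 := prodExp_exp_image_le hp0 hp h (w := w) (by positivity) hl0 (fun v => by positivity)
    hle hsum.ge G.card le_rfl (fun i => x (e.symm i))
  rw [← prodExp_equiv e] at h4
  have h5 : ∀ y : {a // a ∈ G} → V, Finset.univ.image (y ∘ e.symm) = Finset.univ.image y := by
    intro y
    ext v
    simp only [Finset.mem_image, Finset.mem_univ, true_and, Function.comp]
    exact e.symm.exists_congr_left.trans (by simp)
  have h6 : (fun a : {a // a ∈ G} => moveWeight p (fun i => x (e.symm i)) (e a)) =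
      fun a : {a // a ∈ G} => moveWeight p x a := by
    funext a v; simp [moveWeight]
  simp only [h5, h6] at h4
  refine h4.trans (Real.exp_le_exp.2 (neg_le_neg ?_))
  have hcard : (Fintype.card A : ℝ) = G.card + w := by
    rw [hwdef]; exact_mod_cast (Finset.card_add_card_compl G).symm
  have hw0 : 0 ≤ w := by positivity
  have h7 : l * w ≤ p * w := by
    rw [hl]; nlinarith [mul_nonneg hp0 hw0]
  calc u * (G.card * w * p * (1 - (Fintype.card A + 1) * p))
      = G.card * (l * w * (1 - (G.card + 1) * p - p * w)) := by rw [hl, hcard]; ring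
    _ ≤ _ := by gcongr

omit [DecidableEq V] in
lemma le_prodExp_of_pow_le {μ : A → V → ℝ} (h0 : ∀ a v, 0 ≤ μ a v) (h1 : ∀ a, ∑ v, μ a v = 1)
    (N : (A → V) → ℕ) (c : ℝ) (h : ∀ u : ℝ, 0 ≤ u → u ≤ 1 →
      prodExp μ (fun y => (1 - u) ^ N y) ≤ Real.exp (-(u * c))) :
    c ≤ prodExp μ (fun y => (N y : ℝ)) := by
  rcases le_total c 0 with hc | hc
  · exact hc.trans ((prodExp_const h1 0).symm.le.trans
      (prodExp_mono h0 fun y => Nat.cast_nonneg _))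
  have key : ∀ u : ℝ, 0 < u → u ≤ 1 → c - u * c ^ 2 ≤ prodExp μ (fun y => (N y : ℝ)) := by
    intro u hu0 hu1
    have h2 : 1 + -u * prodExp μ (fun y => (N y : ℝ)) ≤ Real.exp (-(u * c)) := by
      refine le_trans ?_ (h u hu0.le hu1)
      rw [← prodExp_const_mul]
      nth_rewrite 1 [← prodExp_const h1 1]
      rw [← prodExp_add]
      refine prodExp_mono h0 fun y => ?_
      have := one_add_mul_le_pow (a := -u) (by linarith) (N y)
      rw [← sub_eq_add_neg] at this
      linarith
    have h3 := exp_neg_le_quadratic (mul_nonneg hu0.le hc)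
    have h4 : u * (c - u * c ^ 2) ≤ u * prodExp μ (fun y => (N y : ℝ)) := by nlinarith
    exact le_of_mul_le_mul_left h4 hu0
  refine le_of_forall_pos_le_add fun ε hε => ?_
  have hc2 : 0 < c ^ 2 + 1 := by positivity
  have hu : 0 < min 1 (ε / (c ^ 2 + 1)) := by positivity
  have h5 := key _ hu (min_le_left _ _)
  have h6 : min 1 (ε / (c ^ 2 + 1)) * c ^ 2 ≤ ε := by
    calc min 1 (ε / (c ^ 2 + 1)) * c ^ 2 ≤ ε / (c ^ 2 + 1) * (c ^ 2 + 1) := by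
          gcongr
          · exact min_le_right _ _
          · linarith
      _ = ε := by field_simp
  linarith

/-- Expected number of green agents after a round: upper bound. -/
lemma prodExp_card_spread_le {μ : A → V → ℝ} (h0 : ∀ a v, 0 ≤ μ a v)
    (h1 : ∀ a, ∑ v, μ a v = 1) {p : ℝ} (hp0 : 0 ≤ p) (hp : ∀ a v, μ a v ≤ p) (G : Finset A) :
    prodExp μ (fun y => ((spread G y).card : ℝ)) ≤ G.card + G.card * p * Gᶜ.card := by
  have key : (1 - G.card * p) * Gᶜ.card ≤ prodExp μ (fun y => ((spread G y)ᶜ.card : ℝ)) := by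
    rcases le_total (1 - G.card * p) 0 with hc | hc
    · exact (mul_nonpos_of_nonpos_of_nonneg hc (Nat.cast_nonneg _)).trans
        ((prodExp_const h1 0).symm.le.trans (prodExp_mono h0 fun y => Nat.cast_nonneg _))
    refine le_prodExp_of_pow_le h0 h1 _ _ fun u hu0 hu1 => ?_
    refine (prodExp_pow_card_compl_spread_le h0 h1 hp0 hp G hu0 hu1).trans ?_
    have h2 : 1 - (1 - G.card * p) * u ≤ Real.exp (-((1 - G.card * p) * u)) := by
      linarith [Real.add_one_le_exp (-((1 - G.card * p) * u))]
    have h3 : 0 ≤ 1 - (1 - G.card * p) * u := by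
      have : 0 ≤ G.card * p := by positivity
      nlinarith
    refine (pow_le_pow_left₀ h3 h2 _).trans_eq ?_
    rw [← Real.exp_nat_mul]
    congr 1; ring
  have hcard : ∀ H : Finset A, (H.card : ℝ) = Fintype.card A + -1 * Hᶜ.card := fun H => by
    rw [← Finset.card_add_card_compl H]; push_cast; ring
  simp only [hcard (spread G _)]
  rw [prodExp_add, prodExp_const_mul, prodExp_const h1, ← Finset.card_add_card_compl G]
  push_cast
  linarith

/-- Expected number of white agents after a round: upper bound. -/
lemma prodExp_card_compl_spread_le {p : ℝ} (hp0 : 0 ≤ p)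
    (hp : ((Fintype.card V : ℝ) - 1) * p = 1) (x : A → V) (G : Finset A) :
    prodExp (moveWeight p x) (fun y => ((spread G y)ᶜ.card : ℝ)) ≤
      (1 - G.card * p * (1 - (Fintype.card A + 1) * p)) * Gᶜ.card := by
  have key := le_prodExp_of_pow_le (moveWeight_nonneg hp0 x) (sum_moveWeight hp x) _ _
    fun u hu0 hu1 => prodExp_pow_card_spread_sdiff_le hp0 hp x G hu0 hu1
  have hcard : ∀ y : A → V, ((spread G y)ᶜ.card : ℝ) = Gᶜ.card + -1 * (spread G y \ G).card := by
    intro y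
    have h1 := Finset.card_sdiff_add_card_eq_card (subset_spread G y)
    have h2 := Finset.card_add_card_compl G
    have h3 := Finset.card_add_card_compl (spread G y)
    have h4 : ((spread G y)ᶜ.card : ℝ) + (spread G y \ G).card = Gᶜ.card := by
      norm_cast; omega
    linarith
  simp only [hcard]
  rw [prodExp_add, prodExp_const_mul, prodExp_const (sum_moveWeight hp x)]
  linarith

end kernelBounds


section chain

variable {n k : ℕ}

/-- One-step expectation of a function of the positions and the green set. -/
noncomputable def stepExp (F : (Fin k → Fin n) → Finset (Fin k) → ℝ)
    (x : Fin k → Fin n) (G : Finset (Fin k)) : ℝ :=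
  prodExp (moveWeight ((n : ℝ) - 1)⁻¹ x) (fun y => F y (spread G y))

/-- Expectation of a function of the positions and the green set at the end of round `T`. -/
noncomputable def roundExp (T : ℕ) (F : (Fin k → Fin n) → Finset (Fin k) → ℝ) : ℝ :=
  ∑ p : Fin (T + 1) → Fin k → Fin n, prefixProb n k T p * F (p (Fin.last T))
    (greenSet n k (fun t a => p ⟨min t T, Nat.lt_succ_of_le (min_le_right t T)⟩ a) T)

lemma probXiLe_eq (T : ℕ) :
    probXiLe n k T = roundExp T (fun (_ : Fin k → Fin n) G => if G = Finset.univ then 1 else 0) := by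
  simp [probXiLe, roundExp]

lemma greenSet_congr {p p' : ℕ → Fin k → Fin n} {T : ℕ} (h : ∀ t ≤ T, p t = p' t) :
    greenSet n k p T = greenSet n k p' T := by
  induction T with
  | zero => simp [greenSet, h 0 le_rfl]
  | succ T ih => simp [greenSet, h (T + 1) le_rfl, ih fun t ht => h t (by omega)]

lemma greenSet_nonempty (hk : 0 < k) (p : ℕ → Fin k → Fin n) (T : ℕ) :
    (greenSet n k p T).Nonempty := by
  induction T with
  | zero => exact ⟨⟨0, hk⟩, by simp [greenSet]; exact ⟨⟨0, hk⟩, rfl, rfl⟩⟩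
  | succ T ih => exact ih.mono Finset.subset_union_left

lemma inv_pred_nonneg (hn : 2 ≤ n) : 0 ≤ ((n : ℝ) - 1)⁻¹ := by
  have : (2 : ℝ) ≤ n := by exact_mod_cast hn
  exact inv_nonneg.2 (by linarith)

lemma pred_mul_inv (hn : 2 ≤ n) : ((Fintype.card (Fin n) : ℝ) - 1) * ((n : ℝ) - 1)⁻¹ = 1 := by
  have : (2 : ℝ) ≤ n := by exact_mod_cast hn
  rw [Fintype.card_fin]
  exact mul_inv_cancel₀ (by linarith)

lemma prefixProb_nonneg (hn : 2 ≤ n) (T : ℕ) (p : Fin (T + 1) → Fin k → Fin n) :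
    0 ≤ prefixProb n k T p := by
  have := inv_pred_nonneg hn
  refine Finset.prod_nonneg fun a _ => mul_nonneg (by positivity) (Finset.prod_nonneg fun t _ => ?_)
  split_ifs <;> simp [this]

lemma roundExp_succ (T : ℕ) (F : (Fin k → Fin n) → Finset (Fin k) → ℝ) :
    roundExp (T + 1) F = roundExp T (stepExp F) := by
  unfold roundExp
  rw [← (Fin.snocEquiv (fun _ : Fin (T + 1 + 1) => Fin k → Fin n)).sum_comp,
    Fintype.sum_prod_type, Finset.sum_comm]
  refine Finset.sum_congr rfl fun p _ => ?_
  unfold stepExp prodExp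
  rw [Finset.mul_sum]
  refine Finset.sum_congr rfl fun y _ => ?_
  set P : Fin (T + 1 + 1) → Fin k → Fin n :=
    Fin.snocEquiv (fun _ : Fin (T + 1 + 1) => Fin k → Fin n) (y, p) with hP
  have hlast : P (Fin.last (T + 1)) = y := by simp [hP, Fin.snocEquiv]
  have hcast : ∀ i : Fin (T + 1), P i.castSucc = p i := fun i => by
    simp [hP, Fin.snocEquiv]
  have hprob : prefixProb n k (T + 1) P =
      prefixProb n k T p * ∏ a, moveWeight ((n : ℝ) - 1)⁻¹ (p (Fin.last T)) a (y a) := by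
    unfold prefixProb
    rw [← Finset.prod_mul_distrib]
    refine Finset.prod_congr rfl fun a _ => ?_
    rw [Fin.prod_univ_castSucc, mul_assoc]
    simp only [Fin.succ_last, hlast, hcast, Fin.succ_castSucc, moveWeight]
  have hgreen : greenSet n k (fun t a => P ⟨min t (T + 1),
      Nat.lt_succ_of_le (min_le_right t (T + 1))⟩ a) (T + 1) =
      spread (greenSet n k (fun t a => p ⟨min t T,
        Nat.lt_succ_of_le (min_le_right t T)⟩ a) T) y := by
    have h1 : greenSet n k (fun t a => P ⟨min t (T + 1),
        Nat.lt_succ_of_le (min_le_right t (T + 1))⟩ a) T = greenSet n k (fun t a => p ⟨min t T,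
        Nat.lt_succ_of_le (min_le_right t T)⟩ a) T := by
      refine greenSet_congr fun t ht => ?_
      funext a
      rw [← hcast]
      congr 2
      simp; omega
    have h2 : P ⟨min (T + 1) (T + 1), Nat.lt_succ_of_le (min_le_right (T + 1) (T + 1))⟩ = y := by
      rw [← hlast]; congr 1; ext; simp
    simp only [greenSet, h1, h2, spread]
    congr!
  rw [hprob, hgreen, hlast, mul_assoc]

lemma roundExp_add (s r : ℕ) (F : (Fin k → Fin n) → Finset (Fin k) → ℝ) :
    roundExp (s + r) F = roundExp s (stepExp^[r] F) := by
  induction r generalizing F with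
  | zero => rfl
  | succ r ih => rw [← add_assoc, roundExp_succ, ih, Function.iterate_succ_apply]

lemma roundExp_zero (F : (Fin k → Fin n) → Finset (Fin k) → ℝ) (hk : 0 < k) :
    roundExp 0 F = prodExp (fun _ _ => (n : ℝ)⁻¹) (fun y => F y (spread {⟨0, hk⟩} y)) := by
  unfold roundExp prodExp
  refine Fintype.sum_equiv (Equiv.funUnique (Fin 1) (Fin k → Fin n)) _ _ fun p => ?_
  have h : greenSet n k (fun t a => p ⟨min t 0, Nat.lt_succ_of_le (min_le_right t 0)⟩ a) 0 =
      spread {⟨0, hk⟩} (p 0) := by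
    ext a
    simp only [greenSet, spread, Finset.mem_filter, Finset.mem_univ, true_and, Finset.mem_union,
      Finset.mem_singleton, exists_eq_left]
    constructor
    · rintro ⟨b, hb, h⟩
      obtain rfl : b = ⟨0, hk⟩ := Fin.ext hb
      exact Or.inr h
    · rintro (rfl | h)
      · exact ⟨_, rfl, rfl⟩
      · exact ⟨_, rfl, h⟩
  rw [h]
  simp [prefixProb, Equiv.funUnique]

lemma sum_inv_card (hn : 2 ≤ n) : ∑ _v : Fin n, (n : ℝ)⁻¹ = 1 := by
  have : (n : ℝ) ≠ 0 := by positivity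
  simp [this]

lemma stepExp_const (hn : 2 ≤ n) (c : ℝ) :
    stepExp (fun (_ : Fin k → Fin n) (_ : Finset (Fin k)) => c) = fun _ _ => c := by
  funext x G
  exact prodExp_const (sum_moveWeight (pred_mul_inv hn) x) c

lemma roundExp_const (hn : 2 ≤ n) (hk : 0 < k) (T : ℕ) (c : ℝ) :
    roundExp T (fun (_ : Fin k → Fin n) (_ : Finset (Fin k)) => c) = c := by
  induction T with
  | zero => rw [roundExp_zero _ hk]; exact prodExp_const (fun _ => sum_inv_card hn) c
  | succ T ih => rw [roundExp_succ, stepExp_const hn, ih]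

lemma roundExp_mono (hn : 2 ≤ n) (hk : 0 < k) (T : ℕ)
    {F F' : (Fin k → Fin n) → Finset (Fin k) → ℝ}
    (h : ∀ x G, G.Nonempty → F x G ≤ F' x G) : roundExp T F ≤ roundExp T F' :=
  Finset.sum_le_sum fun p _ => mul_le_mul_of_nonneg_left (h _ _ (greenSet_nonempty hk _ _))
    (prefixProb_nonneg hn T p)

lemma roundExp_add_fun (T : ℕ) (F F' : (Fin k → Fin n) → Finset (Fin k) → ℝ) :
    roundExp T (fun x G => F x G + F' x G) = roundExp T F + roundExp T F' := by
  simp [roundExp, mul_add, Finset.sum_add_distrib]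

lemma roundExp_const_mul (T : ℕ) (c : ℝ) (F : (Fin k → Fin n) → Finset (Fin k) → ℝ) :
    roundExp T (fun x G => c * F x G) = c * roundExp T F := by
  simp only [roundExp, Finset.mul_sum]
  exact Finset.sum_congr rfl fun y _ => by ring

lemma stepExp_mono (hn : 2 ≤ n) {F F' : (Fin k → Fin n) → Finset (Fin k) → ℝ}
    {G : Finset (Fin k)} (h : ∀ y G', G ⊆ G' → F y G' ≤ F' y G') (x : Fin k → Fin n) :
    stepExp F x G ≤ stepExp F' x G :=
  prodExp_mono (moveWeight_nonneg (inv_pred_nonneg hn) x) fun y => h y _ (subset_spread G y)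

lemma stepExp_const_mul (c : ℝ) (F : (Fin k → Fin n) → Finset (Fin k) → ℝ) :
    stepExp (fun x G => c * F x G) = fun x G => c * stepExp F x G := by
  funext x G
  exact prodExp_const_mul _ _ _

lemma iterate_stepExp_le_const (hn : 2 ≤ n) {F : (Fin k → Fin n) → Finset (Fin k) → ℝ} {c : ℝ}
    (h : ∀ x G, F x G ≤ c) (r : ℕ) (x : Fin k → Fin n) (G : Finset (Fin k)) :
    stepExp^[r] F x G ≤ c := by
  induction r generalizing x G with
  | zero => exact h x G
  | succ r ih =>
    rw [Function.iterate_succ_apply']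
    exact (stepExp_mono hn (F' := fun _ _ => c) (fun y G' _ => ih y G') x).trans_eq
      (by rw [stepExp_const hn])

lemma iterate_stepExp_card_le (hn : 2 ≤ n) (r : ℕ) (x : Fin k → Fin n) (G : Finset (Fin k)) :
    stepExp^[r] (fun _ G => (G.card : ℝ)) x G ≤ (1 + k * ((n : ℝ) - 1)⁻¹) ^ r * G.card := by
  have hp := inv_pred_nonneg hn
  induction r generalizing x G with
  | zero => simp
  | succ r ih =>
    rw [Function.iterate_succ_apply']
    refine (stepExp_mono hn (fun y G' _ => ih y G') x).trans ?_
    rw [stepExp_const_mul, pow_succ, mul_assoc]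
    refine mul_le_mul_of_nonneg_left ?_ (by positivity)
    refine (prodExp_card_spread_le (moveWeight_nonneg hp x)
      (sum_moveWeight (pred_mul_inv hn) x) hp (moveWeight_le hp x) G).trans ?_
    have h1 : (Gᶜ.card : ℝ) ≤ k := by
      exact_mod_cast (Finset.card_le_univ _).trans (by simp)
    have h2 : (G.card * ((n : ℝ) - 1)⁻¹) * Gᶜ.card ≤ (G.card * ((n : ℝ) - 1)⁻¹) * k := by gcongr
    linarith

lemma roundExp_zero_card_le (hn : 2 ≤ n) (hk : 0 < k) (hkn : k ≤ n) :
    roundExp 0 (fun (_ : Fin k → Fin n) G => (G.card : ℝ)) ≤ 2 := by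
  rw [roundExp_zero _ hk]
  have hn' : (0 : ℝ) < n := by positivity
  refine (prodExp_card_spread_le (fun _ _ => by positivity) (fun _ => sum_inv_card hn)
    (p := (n : ℝ)⁻¹) (by positivity) (fun _ _ => le_rfl) _).trans ?_
  have h1 : ((({⟨0, hk⟩} : Finset (Fin k))ᶜ).card : ℝ) ≤ n := by
    exact_mod_cast (Finset.card_le_univ _).trans (by simpa using hkn)
  have h2 : (n : ℝ)⁻¹ * ((({⟨0, hk⟩} : Finset (Fin k))ᶜ).card : ℝ) ≤ (n : ℝ)⁻¹ * n := by gcongr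
  rw [inv_mul_cancel₀ hn'.ne'] at h2
  simp only [Finset.card_singleton, Nat.cast_one, one_mul]
  linarith

lemma iterate_stepExp_eq_univ_le (hn : 2 ≤ n) (hq : k * ((n : ℝ) - 1)⁻¹ ≤ 1) (r : ℕ)
    (x : Fin k → Fin n) (G : Finset (Fin k)) :
    stepExp^[r] (fun _ G => if G = Finset.univ then 1 else 0) x G ≤
      (1 - (1 - k * ((n : ℝ) - 1)⁻¹) ^ r) ^ Gᶜ.card := by
  have hp := inv_pred_nonneg hn
  have hq0 : 0 ≤ k * ((n : ℝ) - 1)⁻¹ := by positivity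
  induction r generalizing x G with
  | zero =>
    simp only [Function.iterate_zero, id, pow_zero, sub_self]
    split_ifs with h
    · simp [h]
    · positivity
  | succ r ih =>
    rw [Function.iterate_succ_apply']
    refine (stepExp_mono hn (fun y G' _ => ih y G') x).trans ?_
    set u := (1 - k * ((n : ℝ) - 1)⁻¹) ^ r with hu
    have hu0 : 0 ≤ u := pow_nonneg (by linarith) _
    have hu1 : u ≤ 1 := pow_le_one₀ (by linarith) (by linarith)
    refine (prodExp_pow_card_compl_spread_le (moveWeight_nonneg hp x)
      (sum_moveWeight (pred_mul_inv hn) x) hp (moveWeight_le hp x) G hu0 hu1).trans ?_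
    have h1 : (G.card : ℝ) ≤ k := by
      exact_mod_cast (Finset.card_le_univ _).trans (by simp)
    have h2 : G.card * ((n : ℝ) - 1)⁻¹ ≤ k * ((n : ℝ) - 1)⁻¹ := by gcongr
    have h3 : 0 ≤ G.card * ((n : ℝ) - 1)⁻¹ := by positivity
    refine pow_le_pow_left₀ (by nlinarith) ?_ _
    rw [pow_succ, ← hu]
    nlinarith

/-- While fewer than `M` agents are green, the Laplace transform of the number of green agents
evolves at least as fast as that of a branching process with growth rate `a`. -/
lemma iterate_stepExp_lt_le (hn : 2 ≤ n) {M a : ℝ}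
    (hδ : 0 ≤ 1 - (k + 1) * ((n : ℝ) - 1)⁻¹)
    (haM : a ≤ (k - M) * ((n : ℝ) - 1)⁻¹ * (1 - (k + 1) * ((n : ℝ) - 1)⁻¹))
    {θ : ℕ → ℝ} (hθ0 : ∀ j, 0 ≤ θ j)
    (hθ : ∀ j, θ (j + 1) = θ j + a * (1 - Real.exp (-θ j))) (r : ℕ)
    (x : Fin k → Fin n) (G : Finset (Fin k)) :
    stepExp^[r] (fun _ G => if (G.card : ℝ) < M then 1 else 0) x G ≤
      Real.exp (θ 0 * M) * Real.exp (-(θ r * G.card)) := by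
  have hp := inv_pred_nonneg hn
  induction r generalizing x G with
  | zero =>
    simp only [Function.iterate_zero, id]
    split_ifs with h
    · rw [← Real.exp_add]
      refine Real.one_le_exp ?_
      nlinarith [hθ0 0]
    · positivity
  | succ r ih =>
    by_cases hG : (G.card : ℝ) < M
    · rw [Function.iterate_succ_apply']
      refine (stepExp_mono hn (fun y G' _ => ih y G') x).trans ?_
      rw [stepExp_const_mul]
      refine mul_le_mul_of_nonneg_left ?_ (by positivity)
      have hrew : ∀ y : Fin k → Fin n, Real.exp (-(θ r * (spread G y).card)) =
          Real.exp (-(θ r * G.card)) * (1 - (1 - Real.exp (-θ r))) ^ (spread G y \ G).card := by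
        intro y
        have h1 : ((spread G y).card : ℝ) = (spread G y \ G).card + G.card := by
          exact_mod_cast (Finset.card_sdiff_add_card_eq_card (subset_spread G y)).symm
        rw [sub_sub_cancel, ← Real.exp_nat_mul, ← Real.exp_add, h1]
        congr 1; ring
      unfold stepExp
      simp only [hrew]
      have he : Real.exp (-θ r) ≤ 1 := Real.exp_le_one_iff.2 (by linarith [hθ0 r])
      have he' := Real.exp_pos (-θ r)
      rw [prodExp_const_mul]
      refine (mul_le_mul_of_nonneg_left (prodExp_pow_card_spread_sdiff_le hp (pred_mul_inv hn) x G
        (u := 1 - Real.exp (-θ r)) (by linarith) (by linarith)) (by positivity)).trans ?_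
      rw [← Real.exp_add, hθ]
      refine Real.exp_le_exp.2 ?_
      have h2 : (Gᶜ.card : ℝ) = k - G.card := by
        rw [eq_sub_iff_add_eq]
        exact_mod_cast (Finset.card_compl_add_card G).trans (by simp)
      rw [h2, Fintype.card_fin]
      have h3 : a ≤ (k - G.card) * ((n : ℝ) - 1)⁻¹ * (1 - (k + 1) * ((n : ℝ) - 1)⁻¹) :=
        haM.trans (by gcongr)
      have h4 : 0 ≤ (1 - Real.exp (-θ r)) * G.card := mul_nonneg (by linarith) (by positivity)
      nlinarith [mul_le_mul_of_nonneg_left h3 h4]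
    · have h0 : ∀ (r : ℕ) (x : Fin k → Fin n) (G : Finset (Fin k)), ¬ (G.card : ℝ) < M →
          stepExp^[r] (fun _ G => if (G.card : ℝ) < M then 1 else 0) x G ≤ 0 := by
        intro r
        induction r with
        | zero => intro x G hG; simp [hG]
        | succ r ih =>
          intro x G hG
          rw [Function.iterate_succ_apply']
          refine (stepExp_mono hn (F' := fun _ _ => 0) (fun y G' hG' => ih y G' ?_) x).trans_eq
            (by rw [stepExp_const hn])
          have : (G.card : ℝ) ≤ G'.card := by exact_mod_cast Finset.card_le_card hG'
          linarith
      exact (h0 _ x G hG).trans (by positivity)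

/-- Once at least `M` agents are green, the number of white agents decays geometrically. -/
lemma iterate_stepExp_card_compl_le (hn : 2 ≤ n) {M ρ : ℝ} (hρ : ρ ≤ 1)
    (hδ : 0 ≤ 1 - (k + 1) * ((n : ℝ) - 1)⁻¹)
    (hρM : ρ ≤ M * ((n : ℝ) - 1)⁻¹ * (1 - (k + 1) * ((n : ℝ) - 1)⁻¹)) (r : ℕ)
    (x : Fin k → Fin n) (G : Finset (Fin k)) (hG : M ≤ G.card) :
    stepExp^[r] (fun _ G => (Gᶜ.card : ℝ)) x G ≤ (1 - ρ) ^ r * Gᶜ.card := by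
  have hp := inv_pred_nonneg hn
  induction r generalizing x G with
  | zero => simp
  | succ r ih =>
    rw [Function.iterate_succ_apply']
    refine (stepExp_mono hn (F' := fun _ G => (1 - ρ) ^ r * Gᶜ.card)
      (fun y G' hG' => ih y G' ?_) x).trans ?_
    · exact hG.trans (by exact_mod_cast Finset.card_le_card hG')
    rw [stepExp_const_mul, pow_succ, mul_assoc]
    refine mul_le_mul_of_nonneg_left ?_ (pow_nonneg (by linarith) _)
    refine (prodExp_card_compl_spread_le hp (pred_mul_inv hn) x G).trans ?_
    rw [Fintype.card_fin]
    have h3 : ρ ≤ G.card * ((n : ℝ) - 1)⁻¹ * (1 - (k + 1) * ((n : ℝ) - 1)⁻¹) :=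
      hρM.trans (by gcongr)
    gcongr

end chain

section tails

variable {n k : ℕ}

lemma probXiLe_mono (hn : 2 ≤ n) (hk : 0 < k) : Monotone (probXiLe n k) := by
  refine monotone_nat_of_le_succ fun T => ?_
  rw [probXiLe_eq, probXiLe_eq, roundExp_succ]
  refine roundExp_mono hn hk T fun x G _ => ?_
  split_ifs with h
  · subst h
    have h1 := stepExp_const (n := n) (k := k) hn 1
    refine (congrFun (congrFun h1 x) Finset.univ).symm.le.trans (stepExp_mono hn ?_ x)
    intro y G' hG'
    rw [if_pos (Finset.univ_subset_iff.1 hG')]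
  · have h1 := stepExp_const (n := n) (k := k) hn 0
    refine (congrFun (congrFun h1 x) G).symm.le.trans (stepExp_mono hn ?_ x)
    intro y G' _
    split_ifs <;> simp

lemma probXiLe_nonneg (hn : 2 ≤ n) (T : ℕ) : 0 ≤ probXiLe n k T :=
  Finset.sum_nonneg fun p _ => by
    split_ifs
    · exact prefixProb_nonneg hn T p
    · exact le_rfl

lemma probXiLe_le_one (hn : 2 ≤ n) (hk : 0 < k) (T : ℕ) : probXiLe n k T ≤ 1 := by
  rw [probXiLe_eq]
  refine (roundExp_mono hn hk T (F' := fun _ _ => 1) fun x G _ => ?_).trans_eq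
    (roundExp_const hn hk T 1)
  split_ifs <;> simp

lemma probXiEq_nonneg (hn : 2 ≤ n) (hk : 0 < k) (t : ℕ) : 0 ≤ probXiEq n k t := by
  cases t with
  | zero => exact probXiLe_nonneg hn 0
  | succ t => exact sub_nonneg.2 (probXiLe_mono hn hk (Nat.le_succ t))

lemma sum_range_probXiEq (N : ℕ) :
    ∑ t ∈ Finset.range (N + 1), probXiEq n k t = probXiLe n k N := by
  induction N with
  | zero => simp [probXiEq]
  | succ N ih => rw [Finset.sum_range_succ, ih]; simp [probXiEq]

lemma sum_range_indicator_le_one (hn : 2 ≤ n) (hk : 0 < k) (S : Set ℕ) (N : ℕ) :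
    ∑ t ∈ Finset.range N, S.indicator (probXiEq n k) t ≤ 1 := by
  calc ∑ t ∈ Finset.range N, S.indicator (probXiEq n k) t
      ≤ ∑ t ∈ Finset.range N, probXiEq n k t :=
        Finset.sum_le_sum fun t _ =>
          Set.indicator_le_self' (fun t _ => probXiEq_nonneg hn hk t) t
    _ ≤ ∑ t ∈ Finset.range (N + 1), probXiEq n k t :=
        Finset.sum_le_sum_of_subset_of_nonneg (Finset.range_mono (Nat.le_succ N))
          fun t _ _ => probXiEq_nonneg hn hk t
    _ ≤ 1 := by rw [sum_range_probXiEq]; exact probXiLe_le_one hn hk N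

lemma indicator_probXiEq_nonneg (hn : 2 ≤ n) (hk : 0 < k) (S : Set ℕ) (t : ℕ) :
    0 ≤ S.indicator (probXiEq n k) t :=
  Set.indicator_nonneg (fun t _ => probXiEq_nonneg hn hk t) t

lemma probXiMem_le_one (hn : 2 ≤ n) (hk : 0 < k) (S : Set ℕ) : probXiMem n k S ≤ 1 :=
  Real.tsum_le_of_sum_range_le (indicator_probXiEq_nonneg hn hk S)
    (sum_range_indicator_le_one hn hk S)

lemma sub_le_probXiMem (hn : 2 ≤ n) (hk : 0 < k) (S : Set ℕ) {T₁ T₂ : ℕ} (hT : T₁ ≤ T₂)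
    (hS : ∀ t, T₁ < t → t ≤ T₂ → t ∈ S) :
    probXiLe n k T₂ - probXiLe n k T₁ ≤ probXiMem n k S := by
  have hsum : Summable (S.indicator (probXiEq n k)) :=
    summable_of_sum_range_le (indicator_probXiEq_nonneg hn hk S)
      (sum_range_indicator_le_one hn hk S)
  refine le_trans (le_of_eq ?_) (hsum.sum_le_tsum (Finset.Ico (T₁ + 1) (T₂ + 1))
    fun t _ => indicator_probXiEq_nonneg hn hk S t)
  rw [← sum_range_probXiEq, ← sum_range_probXiEq, ← Finset.sum_Ico_eq_sub _ (by omega)]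
  refine Finset.sum_congr rfl fun t ht => ?_
  rw [Finset.mem_Ico] at ht
  rw [Set.indicator_of_mem (hS t (by omega) (by omega))]

lemma card_compl_fin (G : Finset (Fin k)) : (Gᶜ.card : ℝ) = k - G.card := by
  rw [eq_sub_iff_add_eq]
  exact_mod_cast (Finset.card_compl_add_card G).trans (by simp)

/-- Bound for the probability that the broadcast finishes early. -/
lemma probXiLe_add_le (hn : 2 ≤ n) (hk : 0 < k) (hkn : k ≤ n) (hq : k * ((n : ℝ) - 1)⁻¹ ≤ 1)
    (s r : ℕ) :
    probXiLe n k (s + r) ≤ 4 / k * (1 + k * ((n : ℝ) - 1)⁻¹) ^ s +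
      Real.exp (-((1 - k * ((n : ℝ) - 1)⁻¹) ^ r * (k / 2))) := by
  have hk' : (0 : ℝ) < k := by exact_mod_cast hk
  have hp := inv_pred_nonneg hn
  have hq0 : 0 ≤ k * ((n : ℝ) - 1)⁻¹ := by positivity
  set u := (1 - k * ((n : ℝ) - 1)⁻¹) ^ r with hu
  have hu0 : 0 ≤ u := pow_nonneg (by linarith) _
  have hu1 : u ≤ 1 := pow_le_one₀ (by linarith) (by linarith)
  rw [probXiLe_eq, roundExp_add]
  refine (roundExp_mono hn hk s (F' := fun _ G => 2 / k * G.card + Real.exp (-(u * (k / 2))))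
    fun x G _ => ?_).trans ?_
  · refine (iterate_stepExp_eq_univ_le hn hq r x G).trans ?_
    rw [← hu]
    by_cases hG : (k : ℝ) / 2 ≤ G.card
    · have h1 : 1 ≤ 2 / k * (G.card : ℝ) := by
        rw [div_mul_eq_mul_div, le_div_iff₀ hk']; linarith
      have h2 : (1 - u) ^ Gᶜ.card ≤ 1 := pow_le_one₀ (by linarith) (by linarith)
      linarith [Real.exp_pos (-(u * (k / 2)))]
    · have h1 : (1 - u) ^ Gᶜ.card ≤ Real.exp (-(u * (k / 2))) := by
        refine (pow_le_pow_left₀ (by linarith) (Real.one_sub_le_exp_neg u) _).trans ?_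
        rw [← Real.exp_nat_mul, card_compl_fin]
        refine Real.exp_le_exp.2 ?_
        nlinarith
      have h2 : 0 ≤ 2 / k * (G.card : ℝ) := by positivity
      linarith
  · rw [roundExp_add_fun, roundExp_const hn hk, roundExp_const_mul]
    refine add_le_add ?_ le_rfl
    have h3 : roundExp s (fun (_ : Fin k → Fin n) G => (G.card : ℝ)) ≤
        (1 + k * ((n : ℝ) - 1)⁻¹) ^ s * 2 := by
      rw [← zero_add s, roundExp_add, zero_add]
      refine (roundExp_mono hn hk 0 fun x G _ => iterate_stepExp_card_le hn s x G).trans ?_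
      rw [roundExp_const_mul]
      gcongr
      exact roundExp_zero_card_le hn hk hkn
    calc 2 / k * roundExp s (fun (_ : Fin k → Fin n) G => (G.card : ℝ))
        ≤ 2 / k * ((1 + k * ((n : ℝ) - 1)⁻¹) ^ s * 2) := by gcongr
      _ = _ := by ring

lemma iterate_stepExp_mono (hn : 2 ≤ n) {F F' : (Fin k → Fin n) → Finset (Fin k) → ℝ}
    (h : ∀ x G, F x G ≤ F' x G) (r : ℕ) (x : Fin k → Fin n) (G : Finset (Fin k)) :
    stepExp^[r] F x G ≤ stepExp^[r] F' x G := by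
  induction r generalizing x G with
  | zero => exact h x G
  | succ r ih =>
    rw [Function.iterate_succ_apply', Function.iterate_succ_apply']
    exact stepExp_mono hn (fun y G' _ => ih y G') x

lemma iterate_stepExp_const_mul (c : ℝ) (F : (Fin k → Fin n) → Finset (Fin k) → ℝ) (r : ℕ) :
    stepExp^[r] (fun x G => c * F x G) = fun x G => c * stepExp^[r] F x G := by
  induction r with
  | zero => rfl
  | succ r ih => rw [Function.iterate_succ_apply', Function.iterate_succ_apply', ih,
      stepExp_const_mul]

/-- A functional dominated by the number of white agents is small after a period in which at
least `M` agents are green. -/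
lemma roundExp_add_le_of_le_card_compl (hn : 2 ≤ n) (hk : 0 < k) {M ρ c : ℝ} (hc : 0 ≤ c)
    (hδ : 0 ≤ 1 - (k + 1) * ((n : ℝ) - 1)⁻¹)
    (hρ : ρ ≤ 1) (hρM : ρ ≤ M * ((n : ℝ) - 1)⁻¹ * (1 - (k + 1) * ((n : ℝ) - 1)⁻¹))
    {F : (Fin k → Fin n) → Finset (Fin k) → ℝ} (hF1 : ∀ x G, F x G ≤ 1)
    (hF : ∀ x G, F x G ≤ c * Gᶜ.card) (s r : ℕ) :
    roundExp (s + r) F ≤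
      roundExp s (fun (_ : Fin k → Fin n) G => if (G.card : ℝ) < M then (1 : ℝ) else 0) +
        (1 - ρ) ^ r * (c * k) := by
  have h0 : 0 ≤ (1 - ρ) ^ r := pow_nonneg (by linarith) _
  rw [roundExp_add]
  refine (roundExp_mono hn hk s (F' := fun _ G =>
    (if (G.card : ℝ) < M then (1 : ℝ) else 0) + (1 - ρ) ^ r * (c * k)) fun x G _ => ?_).trans_eq
    (by rw [roundExp_add_fun, roundExp_const hn hk])
  split_ifs with hG
  · have : 0 ≤ (1 - ρ) ^ r * (c * k) := by positivity
    linarith [iterate_stepExp_le_const hn hF1 r x G]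
  · rw [zero_add]
    refine (iterate_stepExp_mono hn hF r x G).trans ?_
    rw [iterate_stepExp_const_mul]
    have h1 := iterate_stepExp_card_compl_le hn hρ hδ hρM r x G (not_lt.1 hG)
    have h2 : (Gᶜ.card : ℝ) ≤ k := by
      exact_mod_cast (Finset.card_le_univ _).trans (by simp)
    calc _ ≤ c * ((1 - ρ) ^ r * Gᶜ.card) := mul_le_mul_of_nonneg_left h1 hc
      _ ≤ c * ((1 - ρ) ^ r * k) := by gcongr
      _ = _ := by ring

/-- Bound for the probability that the broadcast finishes late. -/
lemma one_sub_probXiLe_add_le (hn : 2 ≤ n) (hk : 0 < k) {M₁ M₂ a ρ₁ ρ₂ : ℝ} (hM₂ : M₂ < k)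
    (hδ : 0 ≤ 1 - (k + 1) * ((n : ℝ) - 1)⁻¹)
    (ha : a ≤ (k - M₁) * ((n : ℝ) - 1)⁻¹ * (1 - (k + 1) * ((n : ℝ) - 1)⁻¹))
    {θ : ℕ → ℝ} (hθ0 : ∀ j, 0 ≤ θ j)
    (hθ : ∀ j, θ (j + 1) = θ j + a * (1 - Real.exp (-θ j)))
    (hρ₁ : ρ₁ ≤ 1) (hρM₁ : ρ₁ ≤ M₁ * ((n : ℝ) - 1)⁻¹ * (1 - (k + 1) * ((n : ℝ) - 1)⁻¹))
    (hρ₂ : ρ₂ ≤ 1) (hρM₂ : ρ₂ ≤ M₂ * ((n : ℝ) - 1)⁻¹ * (1 - (k + 1) * ((n : ℝ) - 1)⁻¹))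
    (r₁ r₂ r₃ : ℕ) :
    1 - probXiLe n k (r₁ + r₂ + r₃) ≤ Real.exp (θ 0 * M₁) * Real.exp (-θ r₁) +
      (1 - ρ₁) ^ r₂ * (k / (k - M₂)) + (1 - ρ₂) ^ r₃ * k := by
  have hk' : (0 : ℝ) < k := by exact_mod_cast hk
  have hkM : 0 < k - M₂ := by linarith
  have h1 : 1 - probXiLe n k (r₁ + r₂ + r₃) ≤ roundExp (r₁ + r₂ + r₃)
      (fun (_ : Fin k → Fin n) G => if G = Finset.univ then (0 : ℝ) else 1) := by
    rw [sub_le_iff_le_add, probXiLe_eq, ← roundExp_add_fun]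
    refine (roundExp_const hn hk (r₁ + r₂ + r₃) 1).symm.le.trans
      (roundExp_mono hn hk _ fun x G _ => ?_)
    split_ifs <;> simp
  have h2 : roundExp (r₁ + r₂ + r₃)
      (fun (_ : Fin k → Fin n) G => if G = Finset.univ then (0 : ℝ) else 1) ≤
      roundExp (r₁ + r₂) (fun (_ : Fin k → Fin n) G => if (G.card : ℝ) < M₂ then (1 : ℝ) else 0) +
        (1 - ρ₂) ^ r₃ * k := by
    have := roundExp_add_le_of_le_card_compl hn hk (c := 1) zero_le_one hδ hρ₂ hρM₂
      (F := fun (_ : Fin k → Fin n) G => if G = Finset.univ then (0 : ℝ) else 1)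
      (fun x G => by split_ifs <;> simp) (fun x G => ?_) (r₁ + r₂) r₃
    · simpa using this
    · split_ifs with h
      · positivity
      · have h5 : 0 < Gᶜ.card := Finset.card_pos.2
          (Finset.nonempty_iff_ne_empty.2 fun h6 => h (Finset.compl_eq_empty_iff G |>.1 h6))
        rw [one_mul]
        exact_mod_cast h5
  have h3 : roundExp (r₁ + r₂)
      (fun (_ : Fin k → Fin n) G => if (G.card : ℝ) < M₂ then (1 : ℝ) else 0) ≤
      roundExp r₁ (fun (_ : Fin k → Fin n) G => if (G.card : ℝ) < M₁ then (1 : ℝ) else 0) +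
        (1 - ρ₁) ^ r₂ * (k / (k - M₂)) := by
    have := roundExp_add_le_of_le_card_compl hn hk (c := (k - M₂)⁻¹) (by positivity) hδ hρ₁ hρM₁
      (F := fun (_ : Fin k → Fin n) G => if (G.card : ℝ) < M₂ then (1 : ℝ) else 0)
      (fun x G => by split_ifs <;> simp) (fun x G => ?_) r₁ r₂
    · rwa [div_eq_inv_mul]
    · split_ifs with h
      · rw [card_compl_fin, ← div_eq_inv_mul, le_div_iff₀ hkM]
        linarith
      · positivity
  have h4 : roundExp r₁ (fun (_ : Fin k → Fin n) G => if (G.card : ℝ) < M₁ then (1 : ℝ) else 0) ≤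
      Real.exp (θ 0 * M₁) * Real.exp (-θ r₁) := by
    rw [← zero_add r₁, roundExp_add, zero_add]
    refine (roundExp_mono hn hk 0 (F' := fun _ _ => Real.exp (θ 0 * M₁) * Real.exp (-θ r₁))
      fun x G hG => ?_).trans_eq (roundExp_const hn hk 0 _)
    refine (iterate_stepExp_lt_le hn hδ ha hθ0 hθ r₁ x G).trans ?_
    gcongr
    have : (1 : ℝ) ≤ G.card := by exact_mod_cast hG.card_pos
    nlinarith [hθ0 r₁]
  linarith

end tails

section estimates

lemma exp_sub_sq_le {b : ℝ} (hb0 : 0 ≤ b) : Real.exp (b - b ^ 2) ≤ 1 + b := by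
  have h1 : 1 - (b - b ^ 2) ≤ Real.exp (-(b - b ^ 2)) := Real.one_sub_le_exp_neg _
  have h2 : 0 < 1 - (b - b ^ 2) := by nlinarith
  rw [← neg_neg (b - b ^ 2), Real.exp_neg, inv_le_iff_one_le_mul₀ (Real.exp_pos _)]
  nlinarith [mul_le_mul_of_nonneg_left h1 (by linarith : 0 ≤ 1 + b), pow_nonneg hb0 3]

lemma exp_neg_add_sq_le {q : ℝ} (hq0 : 0 ≤ q) (hq1 : q ≤ 1 / 5) :
    Real.exp (-(q + 2 * q ^ 2)) ≤ 1 - q := by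
  refine (exp_neg_le_quadratic (by positivity)).trans ?_
  nlinarith [mul_nonneg (sq_nonneg q) (by nlinarith : 0 ≤ 1 - 4 * q - 4 * q ^ 2)]

lemma one_sub_pow_le_exp {ρ : ℝ} (hρ : ρ ≤ 1) (r : ℕ) : (1 - ρ) ^ r ≤ Real.exp (-(ρ * r)) := by
  refine (pow_le_pow_left₀ (by linarith) (Real.one_sub_le_exp_neg ρ) r).trans_eq ?_
  rw [← Real.exp_nat_mul]; congr 1; ring

lemma mul_one_sub_le_one_sub_exp {t v : ℝ} (ht : 0 ≤ t) (htv : t ≤ v) :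
    t * (1 - v) ≤ 1 - Real.exp (-t) := by
  nlinarith [exp_neg_le_quadratic ht]

section recursion

variable {θ : ℕ → ℝ} {a v : ℝ}

lemma monotone_of_laplace_recursion (ha : 0 ≤ a)
    (hθ : ∀ j, θ (j + 1) = θ j + a * (1 - Real.exp (-θ j))) (h0 : 0 ≤ θ 0) :
    (∀ j, 0 ≤ θ j) ∧ Monotone θ := by
  have hstep : ∀ j, 0 ≤ θ j → θ j ≤ θ (j + 1) := fun j hj => by
    have : Real.exp (-θ j) ≤ 1 := Real.exp_le_one_iff.2 (by linarith)
    rw [hθ]; nlinarith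
  have hnn : ∀ j, 0 ≤ θ j := by
    intro j
    induction j with
    | zero => exact h0
    | succ j ih => exact ih.trans (hstep j ih)
  exact ⟨hnn, monotone_nat_of_le_succ fun j => hstep j (hnn j)⟩

lemma min_le_of_laplace_recursion (ha : 0 ≤ a)
    (hθ : ∀ j, θ (j + 1) = θ j + a * (1 - Real.exp (-θ j))) (h0 : 0 ≤ θ 0) (hv : v ≤ 1) (j : ℕ) :
    min v (θ 0 * (1 + a * (1 - v)) ^ j) ≤ θ j := by
  obtain ⟨hnn, hmono⟩ := monotone_of_laplace_recursion ha hθ h0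
  induction j with
  | zero => simp
  | succ j ih =>
    rcases le_total v (θ j) with h | h
    · exact (min_le_left _ _).trans (h.trans (hmono (Nat.le_succ j)))
    · rcases h.lt_or_eq with h' | h'
      · have h1 : θ 0 * (1 + a * (1 - v)) ^ j ≤ θ j := by
          rcases min_le_iff.1 ih with h2 | h2
          · linarith
          · exact h2
        refine (min_le_right _ _).trans ?_
        have h3 : 0 ≤ a * (1 - v) := mul_nonneg ha (by linarith)
        rw [pow_succ, ← mul_assoc, hθ]
        have h4 := mul_le_mul_of_nonneg_left (mul_one_sub_le_one_sub_exp (hnn j) h) ha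
        nlinarith [mul_le_mul_of_nonneg_right h1 (by linarith : 0 ≤ 1 + a * (1 - v))]
      · exact (min_le_left _ _).trans (h'.symm.le.trans (hmono (Nat.le_succ j)))

lemma linear_le_of_laplace_recursion (ha : 0 ≤ a)
    (hθ : ∀ j, θ (j + 1) = θ j + a * (1 - Real.exp (-θ j))) (h0 : 0 ≤ θ 0) (hv0 : 0 ≤ v)
    {j : ℕ} (hj : v ≤ θ j) (i : ℕ) :
    i * (a * (v * (1 - v))) ≤ θ (j + i) := by
  obtain ⟨hnn, hmono⟩ := monotone_of_laplace_recursion ha hθ h0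
  induction i with
  | zero => simpa using hnn j
  | succ i ih =>
    have h1 : v ≤ θ (j + i) := hj.trans (hmono (Nat.le_add_right j i))
    have h2 : Real.exp (-θ (j + i)) ≤ Real.exp (-v) := Real.exp_le_exp.2 (by linarith)
    have h3 := mul_one_sub_le_one_sub_exp hv0 le_rfl
    have h4 : a * (v * (1 - v)) ≤ a * (1 - Real.exp (-θ (j + i))) := by gcongr; linarith
    rw [← add_assoc, hθ]
    push_cast
    linarith

end recursion

variable {n k : ℕ} {w : ℝ}

lemma two_le_of_mul_le (hk : 0 < k) (hw : 100 ≤ w) (hkw : k * w ≤ n) : 2 ≤ n := by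
  have hk1 : (1 : ℝ) ≤ k := by exact_mod_cast hk
  have : (2 : ℝ) ≤ n := by nlinarith
  exact_mod_cast this

lemma inv_pred_bounds (hk : 0 < k) (hw : 100 ≤ w) (hkw : k * w ≤ n) :
    (k : ℝ) / n ≤ k * ((n : ℝ) - 1)⁻¹ ∧
      k * ((n : ℝ) - 1)⁻¹ ≤ k / n * (1 + 2 / w) ∧ k * ((n : ℝ) - 1)⁻¹ ≤ 2 / w := by
  have hk1 : (1 : ℝ) ≤ k := by exact_mod_cast hk
  have hnw : w ≤ n := by nlinarith
  have hw0 : 0 < w := by linarith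
  have hn0 : (0 : ℝ) < n := by linarith
  have hn1 : (0 : ℝ) < n - 1 := by linarith
  refine ⟨?_, ?_, ?_⟩
  · rw [← div_eq_mul_inv]
    gcongr
    linarith
  · have h1 : ((n : ℝ) - 1)⁻¹ ≤ (n : ℝ)⁻¹ * (1 + 2 / w) := by
      rw [inv_le_iff_one_le_mul₀ hn1]
      field_simp
      nlinarith
    calc k * ((n : ℝ) - 1)⁻¹ ≤ k * ((n : ℝ)⁻¹ * (1 + 2 / w)) := by gcongr
      _ = _ := by ring
  · rw [← div_eq_mul_inv, div_le_div_iff₀ hn1 hw0]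
    linarith

lemma probXiLe_early_le (hk : 0 < k) (hw : 100 ≤ w) (hkw : k * w ≤ n) (hL : w ^ 4 ≤ Real.log k) :
    probXiLe n k (⌊(1 - 8 / w) * (n / k * Real.log k)⌋₊ + ⌊(1 - 8 / w) * (n / k * Real.log k)⌋₊) ≤
      4 * Real.exp (-w) + Real.exp (-(w / 2)) := by
  have hn := two_le_of_mul_le hk hw hkw
  have hk0 : (0 : ℝ) < k := by exact_mod_cast hk
  have hn0 : (0 : ℝ) < n := by positivity
  have hw0 : 0 < w := by linarith
  obtain ⟨hq1, hq2, hq3⟩ := inv_pred_bounds hk hw hkw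
  have hkn : k ≤ n := by
    have : (k : ℝ) ≤ n := by nlinarith
    exact_mod_cast this
  set q := k * ((n : ℝ) - 1)⁻¹ with hq
  set L := Real.log k with hLdef
  set s := ⌊(1 - 8 / w) * (n / k * L)⌋₊ with hs
  have hL0 : 0 ≤ L := le_trans (by positivity) hL
  have hv : 1 / w ≤ 1 / 100 := one_div_le_one_div_of_le (by norm_num) hw
  have hv0 : 0 < 1 / w := by positivity
  have hLw : w ≤ L * (1 / w) := by
    rw [mul_one_div, le_div_iff₀ hw0]
    nlinarith [pow_pos hw0 2, pow_pos hw0 3]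
  rw [show 2 / w = 2 * (1 / w) by ring] at hq2 hq3
  have hs1 : (s : ℝ) ≤ (1 - 8 * (1 / w)) * (n / k * L) := by
    rw [show 8 * (1 / w) = 8 / w by ring]
    refine Nat.floor_le (mul_nonneg ?_ (by positivity))
    rw [show 8 / w = 8 * (1 / w) by ring]; linarith
  set v := 1 / w with hvdef
  have hq0 : 0 ≤ q := le_trans (by positivity) hq1
  have hqs : q * s ≤ (1 + 2 * v) * (1 - 8 * v) * L := by
    calc q * s ≤ (k / n * (1 + 2 * v)) * ((1 - 8 * v) * (n / k * L)) := by gcongr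
      _ = _ := by field_simp
  have hexpL : Real.exp L = k := Real.exp_log hk0
  refine (probXiLe_add_le hn hk hkn (by linarith) s s).trans ?_
  rw [← hq]
  refine add_le_add ?_ (Real.exp_le_exp.2 (neg_le_neg ?_))
  · have h1 : (1 + q) ^ s ≤ Real.exp (q * s) := by
      rw [mul_comm, Real.exp_nat_mul]
      exact pow_le_pow_left₀ (by linarith) (by linarith [Real.add_one_le_exp q]) s
    have h2 : Real.exp (q * s) ≤ Real.exp (L + -w) := by
      refine Real.exp_le_exp.2 (hqs.trans ?_)
      nlinarith [mul_nonneg hL0 (sq_nonneg v), mul_nonneg hL0 hv0.le]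
    rw [Real.exp_add, hexpL] at h2
    calc 4 / k * (1 + q) ^ s ≤ 4 / k * (k * Real.exp (-w)) := by
          gcongr; exact h1.trans h2
      _ = _ := by field_simp
  · have h1 : Real.exp (-(L - w)) ≤ (1 - q) ^ s := by
      refine le_trans ?_ (pow_le_pow_left₀ (Real.exp_pos _).le
        (exp_neg_add_sq_le hq0 (by linarith)) s)
      rw [← Real.exp_nat_mul]
      refine Real.exp_le_exp.2 ?_
      have h2 : q * s * (1 + 2 * q) ≤ (1 + 2 * v) * (1 - 8 * v) * L * (1 + 2 * (2 * v)) := by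
        gcongr
        refine mul_nonneg (mul_nonneg (by linarith) (by linarith)) hL0
      have h3 : (1 + 2 * v) * (1 - 8 * v) * (1 + 2 * (2 * v)) ≤ 1 - v := by
        nlinarith [pow_pos hv0 2, pow_pos hv0 3]
      have h4 := mul_le_mul_of_nonneg_right h3 hL0
      nlinarith
    have h2 : Real.exp (-(L - w)) * k = Real.exp w := by
      rw [← hexpL, ← Real.exp_add]; congr 1; ring
    have h3 : w ≤ Real.exp w := by linarith [Real.add_one_le_exp w]
    nlinarith [mul_le_mul_of_nonneg_right h1 hk0.le]

set_option maxHeartbeats 2000000 in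
lemma one_sub_probXiLe_late_le (hk : 0 < k) (hw : 100 ≤ w) (hkw : k * w ≤ n)
    (hL : w ^ 4 ≤ Real.log k) :
    1 - probXiLe n k (⌈(1 + 16 / w) * (n / k * Real.log k)⌉₊ + ⌈1 / w * (n / k * Real.log k)⌉₊ +
      ⌈1 / w * (n / k * Real.log k)⌉₊ + ⌈(1 + 16 / w) * (n / k * Real.log k)⌉₊) ≤
      Real.exp 1 * Real.exp (-w) + Real.exp (-w) * w + Real.exp (-w) := by
  have hn := two_le_of_mul_le hk hw hkw
  have hk0 : (0 : ℝ) < k := by exact_mod_cast hk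
  have hk1 : (1 : ℝ) ≤ k := by exact_mod_cast hk
  have hn0 : (0 : ℝ) < n := by positivity
  have hw0 : 0 < w := by linarith
  obtain ⟨hq1, hq2, hq3⟩ := inv_pred_bounds hk hw hkw
  have hp := inv_pred_nonneg hn
  set p := ((n : ℝ) - 1)⁻¹ with hpdef
  set q := k * p with hq
  set L := Real.log k with hLdef
  set J := ⌈(1 + 16 / w) * (n / k * L)⌉₊ with hJ
  set I := ⌈1 / w * (n / k * L)⌉₊ with hI
  have hL0 : 0 ≤ L := le_trans (by positivity) hL
  have hv : 1 / w ≤ 1 / 100 := one_div_le_one_div_of_le (by norm_num) hw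
  have hv0 : 0 < 1 / w := by positivity
  rw [show 2 / w = 2 * (1 / w) by ring] at hq2 hq3
  have hJ1 : (1 + 16 * (1 / w)) * (n / k * L) ≤ J := by
    rw [show 16 * (1 / w) = 16 / w by ring]; exact Nat.le_ceil _
  have hI1 : 1 / w * (n / k * L) ≤ I := Nat.le_ceil _
  have hLw : w ≤ L * (1 / w) := by
    rw [mul_one_div, le_div_iff₀ hw0]
    nlinarith [pow_pos hw0 2, pow_pos hw0 3]
  have hLw2 : 2 * w ≤ L * (1 / w) ^ 2 := by
    rw [one_div, inv_pow, ← div_eq_mul_inv, le_div_iff₀ (by positivity)]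
    nlinarith [pow_pos hw0 2, pow_pos hw0 3]
  have hwv : w * (1 / w) = 1 := by field_simp
  set v := 1 / w with hvdef
  have hq0 : 0 ≤ q := le_trans (by positivity) hq1
  set D := 1 - (k + 1) * p with hD
  have hD1 : 1 - 4 * v ≤ D := by
    have : p ≤ q := by rw [hq]; nlinarith
    have h2 : (k + 1) * p = q + p := by rw [hq]; ring
    rw [hD, h2]; linarith
  have hD0 : 0 ≤ D := by linarith
  have hD2 : D ≤ 1 := by
    have : 0 ≤ (k + 1) * p := by positivity
    rw [hD]; linarith
  have hkey : k / n * (n / k * L) = L := by field_simp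
  set a := (k - k * v) * p * D with ha
  have ha' : a = q * (1 - v) * D := by rw [ha, hq]; ring
  have h1v : 0 ≤ 1 - v := by linarith
  have ha0 : 0 ≤ a := by rw [ha']; positivity
  set θ : ℕ → ℝ := fun j => (fun t => t + a * (1 - Real.exp (-t)))^[j] (1 / k) with hθdef
  have hθ : ∀ j, θ (j + 1) = θ j + a * (1 - Real.exp (-θ j)) := fun j => by
    simp only [hθdef, Function.iterate_succ_apply']
  have hθ0 : θ 0 = 1 / k := rfl
  have hθ0' : 0 ≤ θ 0 := by rw [hθ0]; positivity
  obtain ⟨hnn, -⟩ := monotone_of_laplace_recursion ha0 hθ hθ0'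
  have hexpL : Real.exp L = k := Real.exp_log hk0
  set b := a * (1 - v) with hb
  have hb0 : 0 ≤ b := by positivity
  have hbq : b ≤ 2 * v := by
    rw [hb, ha']
    calc q * (1 - v) * D * (1 - v) ≤ q * 1 * 1 * 1 := by gcongr <;> linarith
      _ ≤ 2 * v := by linarith
  have hbl : k / n * (1 - 6 * v) ≤ b := by
    rw [hb, ha']
    calc k / n * (1 - 6 * v) ≤ k / n * ((1 - v) * (1 - 4 * v) * (1 - v)) := by
          gcongr
          nlinarith [pow_pos hv0 2, pow_pos hv0 3]
      _ = k / n * (1 - v) * (1 - 4 * v) * (1 - v) := by ring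
      _ ≤ q * (1 - v) * D * (1 - v) := by gcongr; linarith
  have hθJ : v ≤ θ J := by
    refine le_trans (le_min le_rfl ?_) (min_le_of_laplace_recursion ha0 hθ hθ0'
      (v := v) (by linarith) J)
    rw [hθ0, ← hb]
    have h1 : (k : ℝ) ≤ (1 + b) ^ J := by
      refine le_trans ?_ (pow_le_pow_left₀ (Real.exp_pos _).le
        (exp_sub_sq_le hb0) J)
      rw [← Real.exp_nat_mul, ← hexpL]
      refine Real.exp_le_exp.2 ?_
      calc L ≤ (1 + 16 * v) * ((1 - 6 * v) * (1 - 2 * v)) * L := by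
            refine le_mul_of_one_le_left hL0 ?_
            nlinarith [pow_pos hv0 2, pow_pos hv0 3]
        _ = (1 + 16 * v) * (n / k * L) * (k / n * (1 - 6 * v) * (1 - 2 * v)) := by
            nth_rewrite 1 [← hkey]; ring
        _ ≤ J * (b * (1 - b)) := by
            have : 0 ≤ 1 - 6 * v := by linarith
            have : 0 ≤ 1 - 2 * v := by linarith
            gcongr
        _ = _ := by ring
    rw [one_div_mul_eq_div, le_div_iff₀ hk0]
    nlinarith
  have hθI : w ≤ θ (J + I) := by
    refine le_trans ?_ (linear_le_of_laplace_recursion ha0 hθ hθ0' hv0.le hθJ I)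
    calc w ≤ (1 - 6 * v) * (L * v ^ 2) := by nlinarith
      _ = v * (n / k * L) * (v * (k / n * (1 - 6 * v))) := by
          nth_rewrite 1 [← hkey]; ring
      _ ≤ I * (v * b) := by
          have : 0 ≤ 1 - 6 * v := by linarith
          gcongr
      _ = _ := by rw [hb]; ring
  have hρ₁ : k * v * p * D ≤ 1 := by
    calc k * v * p * D = q * v * D := by rw [hq]; ring
      _ ≤ 1 * 1 * 1 := by gcongr <;> linarith
      _ = 1 := by norm_num
  have hρ₂ : k * (1 - v) * p * D ≤ 1 := by
    calc k * (1 - v) * p * D = q * (1 - v) * D := by rw [hq]; ring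
      _ ≤ 1 * 1 * 1 := by gcongr <;> linarith
      _ = 1 := by norm_num
  refine (one_sub_probXiLe_add_le hn hk (M₁ := k * v) (M₂ := k * (1 - v)) (a := a) (by nlinarith)
    hD0 le_rfl hnn hθ hρ₁ le_rfl hρ₂ le_rfl (J + I) I J).trans ?_
  have hdiv : (k : ℝ) / (k - k * (1 - v)) = w := by
    rw [hvdef]; field_simp; ring
  rw [hdiv]
  refine add_le_add (add_le_add ?_ ?_) ?_
  · gcongr
    rw [hθ0, one_div_mul_eq_div, mul_div_assoc, mul_div_cancel₀ _ hk0.ne']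
    linarith
  · gcongr
    refine (one_sub_pow_le_exp hρ₁ I).trans (Real.exp_le_exp.2 (neg_le_neg ?_))
    calc w ≤ (1 - 4 * v) * (L * v ^ 2) := by nlinarith
      _ = k / n * v * (1 - 4 * v) * (v * (n / k * L)) := by
          nth_rewrite 1 [← hkey]; ring
      _ ≤ q * v * D * I := by
          have : 0 ≤ 1 - 4 * v := by linarith
          gcongr
      _ = _ := by rw [hq]; ring
  · have h1 : L + w ≤ k * (1 - v) * p * D * J := by
      calc L + w ≤ ((1 - v) * (1 - 4 * v) * (1 + 16 * v)) * L := by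
            have : 1 + v ≤ (1 - v) * (1 - 4 * v) * (1 + 16 * v) := by
              nlinarith [pow_pos hv0 2, pow_pos hv0 3]
            nlinarith [mul_le_mul_of_nonneg_right this hL0]
        _ = k / n * (1 - v) * (1 - 4 * v) * ((1 + 16 * v) * (n / k * L)) := by
            nth_rewrite 1 [← hkey]; ring
        _ ≤ q * (1 - v) * D * J := by
            have : 0 ≤ 1 - 4 * v := by linarith
            gcongr
        _ = _ := by rw [hq]; ring
    calc (1 - k * (1 - v) * p * D) ^ J * k ≤ Real.exp (-(L + w)) * Real.exp L := by
          rw [hexpL]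
          gcongr
          exact (one_sub_pow_le_exp hρ₂ J).trans (Real.exp_le_exp.2 (neg_le_neg h1))
      _ = Real.exp (-w) := by rw [← Real.exp_add]; congr 1; ring

lemma probXiMem_window_ge (hk : 0 < k) (hw : 100 ≤ w) (hkw : k * w ≤ n)
    (hL : w ^ 4 ≤ Real.log k) :
    1 - (4 * Real.exp (-w) + Real.exp (-(w / 2)) +
      (Real.exp 1 * Real.exp (-w) + Real.exp (-w) * w + Real.exp (-w))) ≤
      probXiMem n k {t | |(t : ℝ) * k / (2 * n * Real.log k) - 1| ≤ 18 / w} := by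
  have hn := two_le_of_mul_le hk hw hkw
  have hk0 : (0 : ℝ) < k := by exact_mod_cast hk
  have hn0 : (0 : ℝ) < n := by positivity
  have hw0 : 0 < w := by linarith
  have h1 := probXiLe_early_le hk hw hkw hL
  have h2 := one_sub_probXiLe_late_le hk hw hkw hL
  have hLpos : 0 < Real.log k := lt_of_lt_of_le (by positivity) hL
  set A := n / k * Real.log k with hA
  have hnk : w ≤ n / k := by rw [le_div_iff₀ hk0]; linarith
  have hAw : 2 * w ≤ A := by
    have : 2 ≤ Real.log k := le_trans (by nlinarith [pow_pos hw0 2, pow_pos hw0 3]) hL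
    calc 2 * w = w * 2 := by ring
      _ ≤ _ := by rw [hA]; gcongr
  have hA0 : 0 < A := by linarith
  have h8 : 8 / w ≤ 8 / 100 := by gcongr
  have hvA : 2 ≤ 1 / w * A := by rw [one_div_mul_eq_div, le_div_iff₀ hw0]; exact hAw
  have hs := Nat.lt_floor_add_one ((1 - 8 / w) * A)
  have hJ := Nat.ceil_lt_add_one (a := (1 + 16 / w) * A) (by positivity)
  have hI := Nat.ceil_lt_add_one (a := 1 / w * A) (by positivity)
  have hle : ⌊(1 - 8 / w) * A⌋₊ ≤ ⌈(1 + 16 / w) * A⌉₊ := by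
    refine (Nat.floor_le_floor ?_).trans (Nat.floor_le_ceil _)
    gcongr
    have : 0 < 8 / w := by positivity
    have : 0 < 16 / w := by positivity
    linarith
  refine le_trans (by linarith) (sub_le_probXiMem
    (T₁ := ⌊(1 - 8 / w) * A⌋₊ + ⌊(1 - 8 / w) * A⌋₊)
    (T₂ := ⌈(1 + 16 / w) * A⌉₊ + ⌈1 / w * A⌉₊ + ⌈1 / w * A⌉₊ + ⌈(1 + 16 / w) * A⌉₊)
    hn hk _ (by omega) fun t ht1 ht2 => ?_)
  have ht1' : (⌊(1 - 8 / w) * A⌋₊ : ℝ) + ⌊(1 - 8 / w) * A⌋₊ < t := by exact_mod_cast ht1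
  have ht2' : (t : ℝ) ≤ ⌈(1 + 16 / w) * A⌉₊ + ⌈1 / w * A⌉₊ + ⌈1 / w * A⌉₊ +
      ⌈(1 + 16 / w) * A⌉₊ := by exact_mod_cast ht2
  have hrw : (t : ℝ) * k / (2 * n * Real.log k) = t / (2 * A) := by
    rw [hA]; field_simp
  rw [Set.mem_ofPred_eq, hrw, abs_le]
  have e8 : (1 - 8 / w) * A = A - 8 * (1 / w * A) := by ring
  have e16 : (1 + 16 / w) * A = A + 16 * (1 / w * A) := by ring
  have e18 : 18 / w * (2 * A) = 36 * (1 / w * A) := by ring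
  constructor
  · rw [neg_le_sub_iff_le_add, ← sub_le_iff_le_add, le_div_iff₀ (by positivity), sub_mul]
    linarith
  · rw [sub_le_iff_le_add, div_le_iff₀ (by positivity), add_mul]
    linarith

end estimates

section asymptotics

lemma eventually_pow_four_le_log {ω₀ : ℕ → ℝ} (hω₀ : Tendsto ω₀ atTop atTop)
    (hω₀le : ∀ᶠ n : ℕ in atTop, ω₀ n ≤ Real.log (Real.log n)) {k : ℕ → ℕ}
    (hk : ∀ᶠ n : ℕ in atTop, (n : ℝ) ^ ((1 : ℝ) / 3) / Real.log n ≤ (k n : ℝ)) :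
    ∀ᶠ n : ℕ in atTop, ω₀ n ^ 4 ≤ Real.log (k n) := by
  have hlog : Tendsto (fun n : ℕ => Real.log n) atTop atTop :=
    Real.tendsto_log_atTop.comp tendsto_natCast_atTop_atTop
  have hloglog : Tendsto (fun n : ℕ => Real.log (Real.log n)) atTop atTop :=
    Real.tendsto_log_atTop.comp hlog
  have hsmall : ∀ᶠ y : ℝ in atTop, y ^ 4 + y ≤ Real.exp y / 3 := by
    have h4 := (Real.isLittleO_pow_exp_atTop (n := 4)).bound (by norm_num : (0 : ℝ) < 1 / 6)
    filter_upwards [h4, eventually_ge_atTop 1] with y hy hy1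
    rw [Real.norm_of_nonneg (by positivity), Real.norm_of_nonneg (by positivity)] at hy
    have : y ≤ y ^ 4 := le_self_pow₀ hy1 (by norm_num)
    linarith
  filter_upwards [hω₀le, hk, hloglog.eventually hsmall, hlog.eventually_gt_atTop 0,
    hω₀.eventually_ge_atTop 0, eventually_gt_atTop 0] with n h1 h2 h3 h4 h5 h6
  rw [Real.exp_log h4] at h3
  have hn : (0 : ℝ) < n := by exact_mod_cast h6
  have h7 : Real.log n / 3 - Real.log (Real.log n) ≤ Real.log (k n) := by
    refine le_trans (le_of_eq ?_) (Real.log_le_log (by positivity) h2)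
    rw [Real.log_div (by positivity) h4.ne', Real.log_rpow hn]
    ring
  have h8 : ω₀ n ^ 4 ≤ Real.log (Real.log n) ^ 4 := pow_le_pow_left₀ h5 h1 4
  linarith

lemma tendsto_window_bound : Tendsto (fun w : ℝ => 1 - (4 * Real.exp (-w) + Real.exp (-(w / 2)) +
    (Real.exp 1 * Real.exp (-w) + Real.exp (-w) * w + Real.exp (-w)))) atTop (nhds 1) := by
  have h1 : Tendsto (fun w : ℝ => Real.exp (-w)) atTop (nhds 0) := 
    Real.tendsto_exp_neg_atTop_nhds_zero
  have h2 : Tendsto (fun w : ℝ => Real.exp (-(w / 2))) atTop (nhds 0) :=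
    h1.comp (tendsto_id.atTop_div_const (by norm_num))
  have h3 : Tendsto (fun w : ℝ => Real.exp (-w) * w) atTop (nhds 0) := by
    simpa [mul_comm] using Real.tendsto_pow_mul_exp_neg_atTop_nhds_zero 1
  simpa using (((h1.const_mul 4).add h2).add
    (((h1.const_mul (Real.exp 1)).add h3).add h1)).const_sub 1

end asymptotics

/-- **Theorem 4.4.**  Let `ω₀ = ω₀(n) ≤ ln ln n` be any function tending to infinity, and suppose
`n^{1/3}/ln n ≤ k = k(n) ≤ n/ω₀`.  Then there is a constant `C > 0` such that a.a.s.
`|ξ(K_n,k)·k/(2 n ln k) − 1| ≤ C/ω₀`. -/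
theorem broadcasting_time_mid_range_k
    (ω₀ : ℕ → ℝ) (hω₀ : Tendsto ω₀ atTop atTop)
    (hω₀le : ∀ᶠ n : ℕ in atTop, ω₀ n ≤ Real.log (Real.log n))
    (k : ℕ → ℕ)
    (hk : ∀ᶠ n : ℕ in atTop,
      (n : ℝ) ^ ((1 : ℝ) / 3) / Real.log n ≤ (k n : ℝ) ∧ (k n : ℝ) ≤ (n : ℝ) / ω₀ n) :
    ∃ C > (0:ℝ), Tendsto (fun n =>
        probXiMem n (k n) {t |
          |(t : ℝ) * (k n) / (2 * n * Real.log (k n)) - 1| ≤ C / ω₀ n})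
      atTop (nhds 1) := by
  refine ⟨18, by norm_num, ?_⟩
  have hpos : ∀ᶠ n : ℕ in atTop, 0 < k n := by
    filter_upwards [hk, eventually_ge_atTop 2] with n hn h2
    have h2' : (1 : ℝ) < n := by exact_mod_cast h2
    have : (0 : ℝ) < (n : ℝ) ^ ((1 : ℝ) / 3) / Real.log n :=
      div_pos (by positivity) (Real.log_pos h2')
    exact_mod_cast this.trans_le hn.1
  refine tendsto_of_tendsto_of_tendsto_of_le_of_le' (tendsto_window_bound.comp hω₀)
    tendsto_const_nhds ?_ ?_
  · filter_upwards [hpos, hk, hω₀.eventually_ge_atTop 100,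
      eventually_pow_four_le_log hω₀ hω₀le (hk.mono fun _ h => h.1)] with n h1 h2 h3 h4
    exact probXiMem_window_ge h1 h3 ((le_div_iff₀ (by linarith)).1 h2.2) h4
  · filter_upwards [hpos, eventually_ge_atTop 2] with n h1 h2
    exact probXiMem_le_one h2 h1 _
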